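/- arXiv:2004.00481 — 7 statements merged into one kernel-verified Lean document; each statement's English description precedes it below -/
import Mathlib

section
/- Soundness of SPJ (select-project-join) query verification: let s1, t1 be multisets over α1, β1 and s2, t2 be multisets over α2, β2 with Multiset.Rel R1 s1 t1 and Multiset.Rel R2 s2 t2. Let p : α1 × α2 → Prop and q : β1 × β2 → Prop be decidable predicates and f : α1 × α2 → γ, g : β1 × β2 → γ projections. Suppose (i) for all a1, b1, a2, b2 with R1 a1 b1 and R2 a2 b2, p (a1, a2) ↔ q (b1, b2), and (ii) for all such a1, b1, a2, b2 with additionally p (a1, a2), f (a1, a2) = g (b1, b2). Then Multiset.map f (Multiset.filter p (s1 ×ˢ s2)) = Multiset.map g (Multiset.filter q (t1 ×ˢ t2)); i.e., the two SPJ queries produce identical output bags. -/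
/-- Soundness of SPJ (select-project-join) query verification: given bijective
pairings between the input bags, if the predicates agree on paired join tuples, and
the projections agree on paired selected tuples, then the two SPJ queries produce
identical output bags. -/
theorem spj_soundness {α1 β1 α2 β2 γ : Type*}
    (s1 : Multiset α1) (t1 : Multiset β1) (s2 : Multiset α2) (t2 : Multiset β2)
    (R1 : α1 → β1 → Prop) (R2 : α2 → β2 → Prop)
    (h1 : Multiset.Rel R1 s1 t1) (h2 : Multiset.Rel R2 s2 t2)
    (p : α1 × α2 → Prop) (q : β1 × β2 → Prop) [DecidablePred p] [DecidablePred q]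
    (f : α1 × α2 → γ) (g : β1 × β2 → γ)
    (hpq : ∀ a1 b1 a2 b2, R1 a1 b1 → R2 a2 b2 → (p (a1, a2) ↔ q (b1, b2)))
    (hfg : ∀ a1 b1 a2 b2, R1 a1 b1 → R2 a2 b2 → p (a1, a2) → f (a1, a2) = g (b1, b2)) :
    Multiset.map f (Multiset.filter p (s1 ×ˢ s2))
      = Multiset.map g (Multiset.filter q (t1 ×ˢ t2)) := by
  induction h1 with
  | zero => simp
  | @cons a b as bs hab _ ih =>
    rw [Multiset.cons_product, Multiset.cons_product, Multiset.filter_add, Multiset.filter_add,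
      Multiset.map_add, Multiset.map_add, ih]
    congr 1
    clear ih
    induction h2 with
    | zero => simp
    | @cons c d cs ds hcd _ ih2 =>
      rw [Multiset.map_cons, Multiset.map_cons]
      by_cases hp : p (a, c)
      · have hq : q (b, d) := (hpq a b c d hab hcd).1 hp
        rw [Multiset.filter_cons_of_pos _ hp, Multiset.filter_cons_of_pos _ hq,
          Multiset.map_cons, Multiset.map_cons, ih2, hfg a b c d hab hcd hp]
      · have hq : ¬ q (b, d) := fun h => hp ((hpq a b c d hab hcd).2 h)
        rw [Multiset.filter_cons_of_neg _ hp, Multiset.filter_cons_of_neg _ hq, ih2]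
end

section
/- Cardinal equivalence of aggregate queries (group count): let s : Multiset α and t : Multiset β with Multiset.Rel R s t, and let g1 : α → K1 and g2 : β → K2 be GROUP BY key functions into types with decidable equality. Suppose the pairing respects grouping: for all a, b, a', b' with R a b and R a' b', g1 a = g1 a' ↔ g2 b = g2 b'. Then the two bags determine the same number of groups: (Multiset.map g1 s).toFinset.card = (Multiset.map g2 t).toFinset.card. -/
/-- Cardinal equivalence of aggregate queries: a bijective pairing respecting
grouping yields the same number of groups on both sides. -/
theorem agg_group_count_eq {α β K1 K2 : Type*} [DecidableEq K1] [DecidableEq K2]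
    (s : Multiset α) (t : Multiset β) (R : α → β → Prop)
    (h : Multiset.Rel R s t) (g1 : α → K1) (g2 : β → K2)
    (hg : ∀ a b a' b', R a b → R a' b' → (g1 a = g1 a' ↔ g2 b = g2 b')) :
    (Multiset.map g1 s).toFinset.card = (Multiset.map g2 t).toFinset.card := by
  induction h with
  | zero => simp
  | @cons a b s t hab hst ih =>
    have key : g1 a ∈ Multiset.map g1 s ↔ g2 b ∈ Multiset.map g2 t := by
      simp only [Multiset.mem_map]
      constructor
      · rintro ⟨a', ha', e⟩
        obtain ⟨b', hb', r⟩ := Multiset.exists_mem_of_rel_of_mem hst ha'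
        exact ⟨b', hb', (hg _ _ _ _ r hab).1 e⟩
      · rintro ⟨b', hb', e⟩
        obtain ⟨a', ha', r⟩ := Multiset.exists_mem_of_rel_of_mem (Multiset.rel_flip.2 hst) hb'
        exact ⟨a', ha', (hg _ _ _ _ r hab).2 e⟩
    rw [Multiset.map_cons, Multiset.map_cons, Multiset.toFinset_cons, Multiset.toFinset_cons,
      Finset.card_insert_eq_ite, Finset.card_insert_eq_ite]
    simp only [Multiset.mem_toFinset, key, ih]
end

section
/- Corresponding groups have equal size: let s : Multiset α and t : Multiset β with Multiset.Rel R s t, and let g1 : α → K1 and g2 : β → K2 be key functions into types with decidable equality such that for all a, b, a', b' with R a b and R a' b', g1 a = g1 a' ↔ g2 b = g2 b'. Then for any a, b with R a b, Multiset.Rel R (Multiset.filter (fun x => g1 x = g1 a) s) (Multiset.filter (fun y => g2 y = g2 b) t); in particular the group of a in s and the group of b in t contain the same number of tuples. -/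
/-- Corresponding groups have equal size: a grouping-respecting bijective pairing
restricts to a pairing between the group of `a` in `s` and the group of `b` in `t`. -/
theorem rel_group_filter {α β K1 K2 : Type*} [DecidableEq K1] [DecidableEq K2]
    (s : Multiset α) (t : Multiset β) (R : α → β → Prop)
    (h : Multiset.Rel R s t) (g1 : α → K1) (g2 : β → K2)
    (hg : ∀ a b a' b', R a b → R a' b' → (g1 a = g1 a' ↔ g2 b = g2 b')) :
    ∀ a b, R a b →
      Multiset.Rel R (Multiset.filter (fun x => g1 x = g1 a) s)
        (Multiset.filter (fun y => g2 y = g2 b) t) := by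
  intro a b hab
  induction h with
  | zero => simp
  | @cons x y s t hxy hst ih =>
    have e := hg x y a b hxy hab
    by_cases hx : g1 x = g1 a
    · rw [Multiset.filter_cons_of_pos (p := fun x => g1 x = g1 a) _ hx,
        Multiset.filter_cons_of_pos (p := fun y => g2 y = g2 b) _ (e.1 hx)]
      exact Multiset.Rel.cons hxy ih
    · rw [Multiset.filter_cons_of_neg (p := fun x => g1 x = g1 a) _ hx,
        Multiset.filter_cons_of_neg (p := fun y => g2 y = g2 b) _ (fun h => hx (e.2 h))]
      exact ih
end

section
/- Soundness of aggregate query verification: let s : Multiset α and t : Multiset β with Multiset.Rel R s t, let g1 : α → K and g2 : β → K be key functions into a type with decidable equality, and let A1 : Multiset α → γ and A2 : Multiset β → γ be aggregate functions. Suppose (i) for all a, b, a', b' with R a b and R a' b', g1 a = g1 a' ↔ g2 b = g2 b', and (ii) for all a, b with R a b, A1 (Multiset.filter (fun x => g1 x = g1 a) s) = A2 (Multiset.filter (fun y => g2 y = g2 b) t). Then the outputs of the two aggregate queries are identical bags: Multiset.map (fun k => A1 (Multiset.filter (fun x => g1 x = k) s)) (Multiset.dedup (Multiset.map g1 s)) =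 Multiset.map (fun k => A2 (Multiset.filter (fun y => g2 y = k) t)) (Multiset.dedup (Multiset.map g2 t)). -/
theorem agg_aux {α β K γ : Type*} [DecidableEq K]
    (s : Multiset α) (t : Multiset β) (R : α → β → Prop)
    (h : Multiset.Rel R s t) (g1 : α → K) (g2 : β → K) (F1 F2 : K → γ)
    (hg : ∀ a b a' b', R a b → R a' b' → (g1 a = g1 a' ↔ g2 b = g2 b'))
    (hF : ∀ a b, R a b → F1 (g1 a) = F2 (g2 b)) :
    Multiset.map F1 (Multiset.dedup (Multiset.map g1 s))
      = Multiset.map F2 (Multiset.dedup (Multiset.map g2 t)) := by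
  induction h with
  | zero => simp
  | @cons a b s t hab hst ih =>
    have key : g1 a ∈ Multiset.map g1 s ↔ g2 b ∈ Multiset.map g2 t := by
      simp only [Multiset.mem_map]
      constructor
      · rintro ⟨x, hx, e⟩
        obtain ⟨y, hy, hxy⟩ := Multiset.exists_mem_of_rel_of_mem hst hx
        exact ⟨y, hy, (hg _ _ _ _ hxy hab).1 e⟩
      · rintro ⟨y, hy, e⟩
        obtain ⟨x, hx, hxy⟩ := Multiset.exists_mem_of_rel_of_mem (Multiset.rel_flip.2 hst) hy
        exact ⟨x, hx, (hg _ _ _ _ hxy hab).2 e⟩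
    rw [Multiset.map_cons, Multiset.map_cons]
    by_cases hm : g1 a ∈ Multiset.map g1 s
    · rw [Multiset.dedup_cons_of_mem hm, Multiset.dedup_cons_of_mem (key.1 hm), ih]
    · rw [Multiset.dedup_cons_of_notMem hm,
        Multiset.dedup_cons_of_notMem (fun h' => hm (key.2 h')),
        Multiset.map_cons, Multiset.map_cons, ih, hF a b hab]

/-- Soundness of aggregate query verification: a grouping-respecting bijective
pairing under which corresponding groups are assigned equal aggregate values yields
identical output bags for the two aggregate queries. -/
theorem agg_soundness {α β K γ : Type*} [DecidableEq K]
    (s : Multiset α) (t : Multiset β) (R : α → β → Prop)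
    (h : Multiset.Rel R s t) (g1 : α → K) (g2 : β → K)
    (A1 : Multiset α → γ) (A2 : Multiset β → γ)
    (hg : ∀ a b a' b', R a b → R a' b' → (g1 a = g1 a' ↔ g2 b = g2 b'))
    (hA : ∀ a b, R a b →
      A1 (Multiset.filter (fun x => g1 x = g1 a) s)
        = A2 (Multiset.filter (fun y => g2 y = g2 b) t)) :
    Multiset.map (fun k => A1 (Multiset.filter (fun x => g1 x = k) s))
        (Multiset.dedup (Multiset.map g1 s))
      = Multiset.map (fun k => A2 (Multiset.filter (fun y => g2 y = k) t))
        (Multiset.dedup (Multiset.map g2 t)) := by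
  exact agg_aux s t R h g1 g2 _ _ hg hA
end

section
/- The multiset of input table names of a cross product is determined by the cardinalities of its instantiations: let N be a type with decidable equality and m1, m2 : Multiset N. If for every assignment c : N → ℕ of a cardinality to each table name, the products agree, i.e., (Multiset.map c m1).prod = (Multiset.map c m2).prod, then m1 = m2. (This captures Case 1 in the completeness proof for SPJ queries: since the cardinality of a cartesian product of tables is the product of the tables' cardinalities, two joins of base tables are cardinally equivalent on all database instances only if they join the same multiset of tables.) -/
theorem join_prod_aux {N : Type*} [DecidableEq N] (a : N) (m : Multiset N) :
    (Multiset.map (fun n => if n = a then 2 else 1) m).prod = 2 ^ m.count a := by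
  induction m using Multiset.induction_on with
  | empty => simp
  | cons b s ih =>
    rw [Multiset.map_cons, Multiset.prod_cons, ih]
    by_cases hb : b = a
    · subst hb
      simp [pow_succ, mul_comm]
    · simp [hb, Multiset.count_cons_of_ne (Ne.symm hb)]

/-- The multiset of input table names of a cross product is determined by the
cardinalities of its instantiations. -/
theorem join_multiset_determined {N : Type*} [DecidableEq N] (m1 m2 : Multiset N)
    (h : ∀ c : N → ℕ, (Multiset.map c m1).prod = (Multiset.map c m2).prod) :
    m1 = m2 := by
  ext a
  have h1 := h (fun n => if n = a then 2 else 1)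
  rw [join_prod_aux, join_prod_aux] at h1
  exact Nat.pow_right_injective (le_refl 2) h1
end

section
/- Soundness of the SPJ merge normalization rule: let s : Multiset α and u : Multiset β, let p2 : α → Prop be a decidable predicate and o2 : α → γ a projection (the inner SPJ query), and let p1 : γ × β → Prop be a decidable predicate and o1 : γ × β → δ a projection (the outer SPJ query). Then Multiset.map o1 (Multiset.filter p1 ((Multiset.map o2 (Multiset.filter p2 s)) ×ˢ u)) = Multiset.map (fun x => o1 (o2 x.1, x.2)) (Multiset.filter (fun x => p2 x.1 ∧ p1 (o2 x.1, x.2)) (s ×ˢ u)); i.e., an SPJ query whose first input is itself an SPJ query is equivalent under bag semantics to a single SPJ query whose predicate is the conjunction of the two predicates (with the inner projection composed in) and whose projection is the composition of the two projections. -/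
/-- Soundness of the SPJ merge normalization rule: an SPJ query whose first input
is itself an SPJ query is equivalent under bag semantics to a single merged SPJ query. -/
theorem spj_merge {α β γ δ : Type*} (s : Multiset α) (u : Multiset β)
    (p2 : α → Prop) [DecidablePred p2] (o2 : α → γ)
    (p1 : γ × β → Prop) [DecidablePred p1] (o1 : γ × β → δ) :
    Multiset.map o1 (Multiset.filter p1 ((Multiset.map o2 (Multiset.filter p2 s)) ×ˢ u))
      = Multiset.map (fun x : α × β => o1 (o2 x.1, x.2))
          (Multiset.filter (fun x : α × β => p2 x.1 ∧ p1 (o2 x.1, x.2)) (s ×ˢ u)) := by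
  induction s using Multiset.induction_on with
  | empty => simp
  | cons a s ih =>
    by_cases h : p2 a
    · rw [Multiset.filter_cons_of_pos _ h, Multiset.map_cons, Multiset.cons_product,
        Multiset.cons_product, Multiset.filter_add, Multiset.filter_add, Multiset.map_add,
        Multiset.map_add, ih]
      congr 1
      simp [Multiset.filter_map, Multiset.map_map, Function.comp_def, h]
    · rw [Multiset.filter_cons_of_neg _ h, Multiset.cons_product, Multiset.filter_add,
        Multiset.map_add, ih]
      simp [Multiset.filter_map, Function.comp_def, h]
end

section
/- Soundness of the aggregate merge normalization rule for SUM: let M be an additive commutative monoid, s : Multiset α, f : α → M, and let k : α → K (coarse GROUP BY key) and k' : α → K' (fine GROUP BY key) be key functions into types with decidable equality such that the fine grouping refines the coarse grouping: k' a = k' b implies k a = k b for all a, b. Then for every coarse key value c, summing f directly over the coarse group equals first summing f within each fine group occurring in the coarse group and then summing those partial sums: (Multiset.map f (Multiset.filter (fun x => k x = c) s)).sum = (Multiset.map (fun j => (Multiset.map f (Multiset.filter (fun x => k' x = j) s)).sum) (Multiset.dedup (Multiset.map k' (Multiset.filter (fun x => k x = c) s)))).sum. -/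
theorem agg_merge_aux {α K' M : Type*} [DecidableEq K'] [AddCommMonoid M]
    (f : α → M) (k' : α → K') (T : Finset K') (t : Multiset α) (h : ∀ x ∈ t, k' x ∈ T) :
    (Multiset.map f t).sum
      = ∑ j ∈ T, (Multiset.map f (Multiset.filter (fun x => k' x = j) t)).sum := by
  induction t using Multiset.induction_on with
  | empty => simp
  | cons a t ih =>
    have ih' := ih (fun x hx => h x (Multiset.mem_cons_of_mem hx))
    have ha := h a (Multiset.mem_cons_self a t)
    have e : ∀ j ∈ T, (Multiset.map f (Multiset.filter (fun x => k' x = j) (a ::ₘ t))).sum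
        = (if k' a = j then f a else 0)
          + (Multiset.map f (Multiset.filter (fun x => k' x = j) t)).sum := by
      intro j _
      by_cases hj : k' a = j <;> simp [hj]
    rw [Finset.sum_congr rfl e, Finset.sum_add_distrib, Finset.sum_ite_eq, if_pos ha, ← ih']
    simp

/-- Soundness of the aggregate merge normalization rule for SUM: when the fine
grouping refines the coarse grouping, summing directly over a coarse group equals
summing the fine-group partial sums. -/
theorem agg_merge_sum {α K K' M : Type*} [DecidableEq K] [DecidableEq K']
    [AddCommMonoid M] (s : Multiset α) (f : α → M) (k : α → K) (k' : α → K')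
    (hrefine : ∀ a b, k' a = k' b → k a = k b) (c : K) :
    (Multiset.map f (Multiset.filter (fun x => k x = c) s)).sum
      = (Multiset.map
          (fun j => (Multiset.map f (Multiset.filter (fun x => k' x = j) s)).sum)
          (Multiset.dedup (Multiset.map k' (Multiset.filter (fun x => k x = c) s)))).sum := by
  rw [agg_merge_aux f k' (Multiset.map k' (Multiset.filter (fun x => k x = c) s)).toFinset
    (Multiset.filter (fun x => k x = c) s)
    (fun x hx => Multiset.mem_toFinset.2 (Multiset.mem_map_of_mem k' hx))]
  change _ = ∑ j ∈ (Multiset.map k' (Multiset.filter (fun x => k x = c) s)).toFinset,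
    (Multiset.map f (Multiset.filter (fun x => k' x = j) s)).sum
  refine Finset.sum_congr rfl fun j hj => ?_
  obtain ⟨a, ha, rfl⟩ := Multiset.mem_map.1 (Multiset.mem_toFinset.1 hj)
  have hc := (Multiset.mem_filter.1 ha).2
  rw [Multiset.filter_filter]
  congr 2
  refine Multiset.filter_congr fun x _ => ?_
  exact ⟨fun hx => hx.1, fun hx => ⟨hx, (hrefine x a hx).trans hc⟩⟩
end
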